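/- arXiv:2203.04840 — 2 statements merged into one kernel-verified Lean document; each statement's English description precedes it below -/
import Mathlib

section
/- For every m ∈ ℕ there exists a constant C > 0, depending only on p, s, γ, m, ρ and φ, such that for every real n ≥ 2, every ε > 0 and every multi-index α ∈ ℕ³ with |α| = m, the regularized initial bubble satisfies ‖∂^α v_nᵉ(0, ·)‖_{L^∞(ℝ³)} ≤ C κ_n n^{3/2−s+m} · min(1, 1/(ε n))^{m+3}. -/
open MeasureTheory Real ENNReal

noncomputable section

abbrev E3 := EuclideanSpace ℝ (Fin 3)

/-- Partial derivative in the `i`-th coordinate direction. -/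
def pd {F : Type} [NormedAddCommGroup F] [NormedSpace ℝ F] (i : Fin 3) (f : E3 → F) : E3 → F :=
  fun x => fderiv ℝ f x (EuclideanSpace.single i 1)

/-- Iterated partial derivative associated with the multi-index `α : Fin 3 → ℕ`. -/
def pda {F : Type} [NormedAddCommGroup F] [NormedSpace ℝ F] (α : Fin 3 → ℕ) (f : E3 → F) :
    E3 → F :=
  (pd 0)^[α 0] ((pd 1)^[α 1] ((pd 2)^[α 2] f))

/-- The approximate identity `ρ_ε`. -/
def rhoeps (ρ : E3 → ℝ) (ε : ℝ) : E3 → ℝ := fun x => (ε ^ 3)⁻¹ * ρ (ε⁻¹ • x)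

def kap (γ n : ℝ) : ℝ := Real.log n ^ (-γ)

def lam (p : ℕ) (s γ n : ℝ) : ℝ :=
  kap γ n ^ (((p : ℝ) - 1) / 2) * n ^ (((3 : ℝ) / 2 - s) * ((p : ℝ) - 1) / 2)

/-- The bubble `v_n(0,·)`. -/
def bubble (s γ : ℝ) (φ : E3 → ℝ) (n : ℝ) : E3 → ℝ :=
  fun x => kap γ n * n ^ ((3 : ℝ) / 2 - s) * φ (n • x)

/-- Convolution of two real valued functions on `ℝ³`. -/
def convR (f g : E3 → ℝ) : E3 → ℝ :=
  MeasureTheory.convolution f g (ContinuousLinearMap.lsmul ℝ ℝ) volume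

/-- The regularized bubble `v_nᵉ(0,·) = ρ_ε ∗ v_n(0,·)`. -/
def bubbleE (s γ : ℝ) (ρ φ : E3 → ℝ) (n ε : ℝ) : E3 → ℝ :=
  convR (rhoeps ρ ε) (bubble s γ φ n)

/-- The ODE profile `v_nᵉ(t,x) = v_nᵉ(0,x) exp(iσt |v_nᵉ(0,x)|^{p-1})`. -/
def vE (σ : ℝ) (p : ℕ) (s γ : ℝ) (ρ φ : E3 → ℝ) (n ε t : ℝ) : E3 → ℂ :=
  fun x => (bubbleE s γ ρ φ n ε x : ℂ) *
    Complex.exp (Complex.I * σ * t * ((|bubbleE s γ ρ φ n ε x| ^ ((p : ℝ) - 1) : ℝ) : ℂ))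
lemma contDiff_pd {f : E3 → ℝ} (hf : ContDiff ℝ (⊤ : ℕ∞) f) (i : Fin 3) :
    ContDiff ℝ (⊤ : ℕ∞) (pd i f) :=
  (hf.fderiv_right (m := (⊤ : ℕ∞)) (by norm_cast)).clm_apply contDiff_const

lemma hasCompactSupport_pd {f : E3 → ℝ} (hf : HasCompactSupport f) (i : Fin 3) :
    HasCompactSupport (pd i f) :=
  hf.fderiv_apply ℝ (EuclideanSpace.single i 1)

lemma contDiff_pd_iterate {f : E3 → ℝ} (hf : ContDiff ℝ (⊤ : ℕ∞) f) (i : Fin 3) (k : ℕ) :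
    ContDiff ℝ (⊤ : ℕ∞) ((pd i)^[k] f) := by
  induction k with
  | zero => exact hf
  | succ k ih => rw [Function.iterate_succ_apply']; exact contDiff_pd ih i

lemma hasCompactSupport_pd_iterate {f : E3 → ℝ} (hf : HasCompactSupport f) (i : Fin 3) (k : ℕ) :
    HasCompactSupport ((pd i)^[k] f) := by
  induction k with
  | zero => exact hf
  | succ k ih => rw [Function.iterate_succ_apply']; exact hasCompactSupport_pd ih i

lemma contDiff_pda {f : E3 → ℝ} (hf : ContDiff ℝ (⊤ : ℕ∞) f) (α : Fin 3 → ℕ) :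
    ContDiff ℝ (⊤ : ℕ∞) (pda α f) :=
  contDiff_pd_iterate (contDiff_pd_iterate (contDiff_pd_iterate hf 2 _) 1 _) 0 _

lemma hasCompactSupport_pda {f : E3 → ℝ} (hf : HasCompactSupport f) (α : Fin 3 → ℕ) :
    HasCompactSupport (pda α f) :=
  hasCompactSupport_pd_iterate
    (hasCompactSupport_pd_iterate (hasCompactSupport_pd_iterate hf 2 _) 1 _) 0 _

lemma pd_const_mul_comp_smul {f : E3 → ℝ} (hf : ContDiff ℝ (⊤ : ℕ∞) f) (i : Fin 3) (c a : ℝ) :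
    pd i (fun x => c * f (a • x)) = fun x => c * a * pd i f (a • x) := by
  funext x
  have hd : DifferentiableAt ℝ f (a • x) := hf.differentiable (by simp) _
  have h := (hd.hasFDerivAt.comp x ((hasFDerivAt_id x).const_smul a)).const_mul c
  have h' : fderiv ℝ (fun x => c * f (a • x)) x = _ := h.fderiv
  simp [pd, h', mul_assoc]

lemma pd_iterate_const_mul_comp_smul {f : E3 → ℝ} (hf : ContDiff ℝ (⊤ : ℕ∞) f) (i : Fin 3)
    (k : ℕ) (c a : ℝ) :
    (pd i)^[k] (fun x => c * f (a • x)) = fun x => c * a ^ k * (pd i)^[k] f (a • x) := by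
  induction k with
  | zero => simp
  | succ k ih =>
    rw [Function.iterate_succ_apply', ih, pd_const_mul_comp_smul (contDiff_pd_iterate hf i k),
      Function.iterate_succ_apply', pow_succ, mul_assoc c]

lemma pda_const_mul_comp_smul {f : E3 → ℝ} (hf : ContDiff ℝ (⊤ : ℕ∞) f) (α : Fin 3 → ℕ)
    (c a : ℝ) :
    pda α (fun x => c * f (a • x)) =
      fun x => c * a ^ (α 0 + α 1 + α 2) * pda α f (a • x) := by
  have h2 := contDiff_pd_iterate hf 2 (α 2)
  have h1 := contDiff_pd_iterate h2 1 (α 1)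
  unfold pda
  rw [pd_iterate_const_mul_comp_smul hf, pd_iterate_const_mul_comp_smul h2,
    pd_iterate_const_mul_comp_smul h1]
  funext x
  ring

lemma convR_comm (f g : E3 → ℝ) : convR f g = convR g f := by
  funext x
  unfold convR
  rw [convolution_lsmul_swap]
  simp only [convolution_def, ContinuousLinearMap.lsmul_apply, smul_eq_mul, mul_comm]

lemma pd_convR {f g : E3 → ℝ} (hf : Continuous f) (hg : ContDiff ℝ (⊤ : ℕ∞) g)
    (hgs : HasCompactSupport g) (i : Fin 3) :
    pd i (convR f g) = convR f (pd i g) := by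
  funext x
  have hg1 : ContDiff ℝ 1 g := hg.of_le (by norm_cast)
  have h := hgs.hasFDerivAt_convolution_right (ContinuousLinearMap.lsmul ℝ ℝ)
    (hf.locallyIntegrable (μ := volume)) hg1 x
  have h' : fderiv ℝ (convR f g) x = _ := h.fderiv
  unfold pd
  rw [h']
  exact convolution_precompR_apply (ContinuousLinearMap.lsmul ℝ ℝ) hf.locallyIntegrable
    (hgs.fderiv ℝ) (hg1.continuous_fderiv (by simp)) x _

lemma pd_iterate_convR {f g : E3 → ℝ} (hf : Continuous f) (hg : ContDiff ℝ (⊤ : ℕ∞) g)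
    (hgs : HasCompactSupport g) (i : Fin 3) (k : ℕ) :
    (pd i)^[k] (convR f g) = convR f ((pd i)^[k] g) := by
  induction k with
  | zero => rfl
  | succ k ih =>
    rw [Function.iterate_succ_apply', ih, pd_convR hf (contDiff_pd_iterate hg i k)
      (hasCompactSupport_pd_iterate hgs i k), Function.iterate_succ_apply']

lemma pda_convR {f g : E3 → ℝ} (hf : Continuous f) (hg : ContDiff ℝ (⊤ : ℕ∞) g)
    (hgs : HasCompactSupport g) (α : Fin 3 → ℕ) :
    pda α (convR f g) = convR f (pda α g) := by
  have c2 := contDiff_pd_iterate hg 2 (α 2)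
  have s2 := hasCompactSupport_pd_iterate hgs 2 (α 2)
  unfold pda
  rw [pd_iterate_convR hf hg hgs, pd_iterate_convR hf c2 s2,
    pd_iterate_convR hf (contDiff_pd_iterate c2 1 _) (hasCompactSupport_pd_iterate s2 1 _)]

lemma abs_convR_le {f g : E3 → ℝ} (hf : Integrable f) {B : ℝ} (hB : ∀ x, |g x| ≤ B) (x : E3) :
    |convR f g x| ≤ (∫ t, |f t|) * B := by
  rw [← integral_mul_const, ← Real.norm_eq_abs, convR, convolution_def]
  refine norm_integral_le_of_norm_le (hf.abs.mul_const B) (Filter.Eventually.of_forall fun t => ?_)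
  simp only [ContinuousLinearMap.lsmul_apply, smul_eq_mul, norm_mul, Real.norm_eq_abs]
  exact mul_le_mul_of_nonneg_left (hB _) (abs_nonneg _)

lemma integral_abs_const_mul_comp_smul (f : E3 → ℝ) {c a : ℝ} (hc : 0 ≤ c) (ha : 0 < a) :
    ∫ x, |c * f (a • x)| = c * (a ^ 3)⁻¹ * ∫ x, |f x| := by
  simp only [abs_mul, abs_of_nonneg hc]
  rw [integral_const_mul, Measure.integral_comp_smul volume (fun x => |f x|)]
  simp [abs_of_pos ha, mul_assoc]

lemma hasCompactSupport_const_mul_comp_smul {f : E3 → ℝ} (hf : HasCompactSupport f) (c : ℝ)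
    {a : ℝ} (ha : a ≠ 0) : HasCompactSupport (fun x => c * f (a • x)) :=
  (hf.comp_smul ha).mul_left

lemma contDiff_const_mul_comp_smul {f : E3 → ℝ} (hf : ContDiff ℝ (⊤ : ℕ∞) f) (c a : ℝ) :
    ContDiff ℝ (⊤ : ℕ∞) (fun x => c * f (a • x)) :=
  contDiff_const.mul (hf.comp (contDiff_id.const_smul a))

lemma abs_pda_convR_scaled_le {f g : E3 → ℝ} (hf : ContDiff ℝ (⊤ : ℕ∞) f)
    (hfs : HasCompactSupport f) (hg : ContDiff ℝ (⊤ : ℕ∞) g) (hgs : HasCompactSupport g)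
    {α : Fin 3 → ℕ} {B : ℝ} (hB : ∀ x, |pda α g x| ≤ B) {a b c d : ℝ} (ha : 0 < a) (hb : 0 < b)
    (hc : 0 ≤ c) (hd : 0 ≤ d) (x : E3) :
    |pda α (convR (fun x => c * f (a • x)) (fun x => d * g (b • x))) x| ≤
      c * (a ^ 3)⁻¹ * (∫ x, |f x|) * (d * b ^ (α 0 + α 1 + α 2) * B) := by
  have hfc := (contDiff_const_mul_comp_smul hf c a).continuous
  rw [pda_convR hfc (contDiff_const_mul_comp_smul hg d b)
    (hasCompactSupport_const_mul_comp_smul hgs d hb.ne'), pda_const_mul_comp_smul hg,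
    ← integral_abs_const_mul_comp_smul f hc ha]
  refine abs_convR_le (hfc.integrable_of_hasCompactSupport
    (hasCompactSupport_const_mul_comp_smul hfs c ha.ne')) (fun y => ?_) x
  have : 0 ≤ d * b ^ (α 0 + α 1 + α 2) := by positivity
  rw [abs_mul, abs_of_nonneg this]
  exact mul_le_mul_of_nonneg_left (hB _) this

lemma exists_abs_pda_le {f : E3 → ℝ} (hf : ContDiff ℝ (⊤ : ℕ∞) f) (hfs : HasCompactSupport f)
    (m : ℕ) :
    ∃ B : ℝ, 0 ≤ B ∧ ∀ α : Fin 3 → ℕ, α 0 + α 1 + α 2 = m → ∀ x, |pda α f x| ≤ B := by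
  choose b hb using fun α : Fin 3 → ℕ =>
    (hasCompactSupport_pda hfs α).exists_bound_of_continuous (contDiff_pda hf α).continuous
  obtain ⟨B, hB⟩ := ((Set.finite_Iic (fun _ : Fin 3 => m)).image b).bddAbove
  refine ⟨max B 0, le_max_right _ _, fun α hα x => (hb α x).trans (le_max_of_le_left
    (hB (Set.mem_image_of_mem b ?_)))⟩
  intro i
  fin_cases i <;> simp <;> omega

/-- `L^∞` bounds on the derivatives of the regularized initial bubble:
for every `m` there is `C > 0` such that for all `n ≥ 2`, `ε > 0` and every multi-index `α`
with `|α| = m`, `‖∂^α v_nᵉ(0)‖_{L^∞} ≤ C κ_n n^{3/2-s+m} min(1, 1/(εn))^{m+3}`. -/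
theorem stmt2
    (σ : ℝ) (hσ : σ = 1 ∨ σ = -1)
    (p : ℕ) (hp_odd : Odd p) (hp : 3 ≤ p)
    (s : ℝ) (hs0 : 0 < s) (hs32 : s < 3 / 2)
    (γ : ℝ) (hγ0 : 0 < γ) (hγ1 : γ < 1)
    (ρ : E3 → ℝ) (hρ_smooth : ContDiff ℝ (⊤ : ℕ∞) ρ) (hρ_supp : HasCompactSupport ρ)
    (hρ_nonneg : ∀ x, 0 ≤ ρ x) (hρ_le : ∀ x, ρ x ≤ 1) (hρ_int : ∫ x, ρ x = 1)
    (φ : E3 → ℝ) (hφ_smooth : ContDiff ℝ (⊤ : ℕ∞) φ)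
    (hφ_supp : tsupport φ ⊆ Metric.closedBall 0 1)
    (hφ_nonneg : ∀ x, 0 ≤ φ x) (hφ_le : ∀ x, φ x ≤ 1)
    (m : ℕ) :
    ∃ C > 0, ∀ n : ℝ, 2 ≤ n → ∀ ε : ℝ, 0 < ε →
      ∀ α : Fin 3 → ℕ, α 0 + α 1 + α 2 = m →
      eLpNorm (pda α (bubbleE s γ ρ φ n ε)) ⊤ volume ≤
        ENNReal.ofReal (C * kap γ n * n ^ ((3 : ℝ) / 2 - s + m) *
          (min 1 (1 / (ε * n))) ^ ((m : ℝ) + 3)) := by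
  have hφ_cs : HasCompactSupport φ :=
    HasCompactSupport.of_support_subset_isCompact (isCompact_closedBall 0 1)
      ((subset_tsupport φ).trans hφ_supp)
  obtain ⟨B, hB0, hB⟩ := exists_abs_pda_le hφ_smooth hφ_cs m
  obtain ⟨D, hD0, hD⟩ := exists_abs_pda_le hρ_smooth hρ_supp m
  have hIφ : 0 ≤ ∫ x, |φ x| := integral_nonneg fun _ => abs_nonneg _
  have hIρ : ∫ x, |ρ x| = 1 := by simp only [abs_of_nonneg (hρ_nonneg _), hρ_int]
  refine ⟨B + (∫ x, |φ x|) * D + 1, by positivity, fun n hn ε hε α hα => ?_⟩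
  have hn0 : 0 < n := by linarith
  have hk : 0 ≤ kap γ n := Real.rpow_nonneg (Real.log_nonneg (by linarith)) _
  set A := kap γ n * n ^ ((3 : ℝ) / 2 - s) with hA
  have hA0 : 0 ≤ A := by positivity
  rw [eLpNorm_exponent_top]
  refine eLpNormEssSup_le_of_ae_bound (Filter.Eventually.of_forall fun x => ?_)
  have h₁ := abs_pda_convR_scaled_le hρ_smooth hρ_supp hφ_smooth hφ_cs (hB α hα)
    (inv_pos.2 hε) hn0 (by positivity : 0 ≤ (ε ^ 3)⁻¹) hA0 x
  have h₂ := abs_pda_convR_scaled_le hφ_smooth hφ_cs hρ_smooth hρ_supp (hD α hα)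
    hn0 (inv_pos.2 hε) hA0 (by positivity : 0 ≤ (ε ^ 3)⁻¹) x
  rw [convR_comm] at h₂
  change |pda α (bubbleE s γ ρ φ n ε) x| ≤ _ at h₁ h₂
  rw [hα] at h₁ h₂
  have e₁ : (ε ^ 3)⁻¹ * ((ε⁻¹) ^ 3)⁻¹ * (∫ x, |ρ x|) * (A * n ^ m * B) = B * (A * n ^ m) := by
    rw [hIρ]; field_simp
  have e₂ : A * (n ^ 3)⁻¹ * (∫ x, |φ x|) * ((ε ^ 3)⁻¹ * (ε⁻¹) ^ m * D) =
      (∫ x, |φ x|) * D * (A * n ^ m) * (1 / (ε * n)) ^ (m + 3) := by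
    rw [one_div, inv_pow, inv_pow, mul_pow]; field_simp; ring
  rw [e₁] at h₁
  rw [e₂] at h₂
  have hpow : n ^ ((3 : ℝ) / 2 - s + m) = n ^ ((3 : ℝ) / 2 - s) * n ^ m := by
    rw [Real.rpow_add hn0, Real.rpow_natCast]
  have hexp : (m : ℝ) + 3 = ((m + 3 : ℕ) : ℝ) := by push_cast; rfl
  rw [Real.norm_eq_abs, hpow, hexp, Real.rpow_natCast]
  have hE : 0 ≤ A * n ^ m := by positivity
  rw [show (B + (∫ x, |φ x|) * D + 1) * kap γ n * (n ^ ((3 : ℝ) / 2 - s) * n ^ m) =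
    (B + (∫ x, |φ x|) * D + 1) * (A * n ^ m) by rw [hA]; ring]
  rcases le_total 1 (1 / (ε * n)) with h | h
  · rw [min_eq_left h, one_pow, mul_one]
    exact h₁.trans (mul_le_mul_of_nonneg_right (by nlinarith [mul_nonneg hIφ hD0]) hE)
  · rw [min_eq_right h]
    refine h₂.trans (mul_le_mul_of_nonneg_right
      (mul_le_mul_of_nonneg_right (by linarith) hE) (by positivity))
end
end

section
/- Assume φ is not identically zero. Then there exist c > 0 and N ≥ 2 such that for every real n ≥ N and every ε ∈ (0, (100 n)^{−1}], the gradient of the regularized bubble at the inflation time t_n satisfies the lower bound ‖∇ v_nᵉ(t_n, ·)‖_{L²(ℝ³)} ≥ c κ_n (log n)^{(β−γ)(p−1)} n^{1−s}, where t_n λ_n² = (log n)^{(β−γ)(p−1)}. -/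
open MeasureTheory Real ENNReal

noncomputable section

/-- The inflation time `t_n := λ_n⁻² (log n)^{(β-γ)(p-1)}`. -/
def tinf (p : ℕ) (s γ β n : ℝ) : ℝ :=
  (lam p s γ n ^ 2)⁻¹ * Real.log n ^ ((β - γ) * ((p : ℝ) - 1))

/-- The gradient of `u e^{iτu^k}` dominates the gradient of its phase weighted by `u`. -/
lemma norm_fderiv_pow_le_norm_fderiv_mul_cexp {E : Type*} [NormedAddCommGroup E]
    [NormedSpace ℝ E] {u : E → ℝ} {x : E} (hu : DifferentiableAt ℝ u x) (τ : ℝ) (k : ℕ) :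
    |τ| * k / (k + 1) * ‖fderiv ℝ (fun y => u y ^ (k + 1)) x‖ ≤
      ‖fderiv ℝ (fun y => (u y : ℂ) * Complex.exp (Complex.I * τ * ((u y ^ k : ℝ) : ℂ))) x‖ := by
  set g : ℝ → ℂ := fun y => (y : ℂ) * Complex.exp (Complex.I * τ * ((y ^ k : ℝ) : ℂ)) with hg
  have hgd : ∀ y : ℝ, HasDerivAt g
      ((1 + Complex.I * ((τ * k * y ^ k : ℝ) : ℂ)) *
        Complex.exp (((τ * y ^ k : ℝ) : ℂ) * Complex.I)) y := by
    intro y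
    have h1 : HasDerivAt (fun y : ℝ => (y : ℂ)) 1 y := Complex.ofRealCLM.hasDerivAt
    have h2 := ((((hasDerivAt_pow k y).ofReal_comp).const_mul (Complex.I * (τ : ℂ))).cexp)
    refine (h1.mul h2).congr_deriv ?_
    have h3 : Complex.I * (τ : ℂ) * ((y ^ k : ℝ) : ℂ) = ((τ * y ^ k : ℝ) : ℂ) * Complex.I := by
      push_cast; ring
    rw [h3]
    rcases k with _ | k
    · simp
    · push_cast
      ring
  have hf : HasFDerivAt (fun y => g (u y)) _ x :=
    (hgd (u x)).hasFDerivAt.comp x hu.hasFDerivAt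
  have hp := (hu.hasFDerivAt.pow (k + 1)).fderiv
  have hk : (0 : ℝ) < k + 1 := by positivity
  have hp' : ‖fderiv ℝ (fun y => u y ^ (k + 1)) x‖ = (k + 1) * |u x| ^ k * ‖fderiv ℝ u x‖ := by
    rw [hp, norm_smul]
    simp [abs_of_pos hk]
  have hv : ‖fderiv ℝ (fun y => g (u y)) x‖ =
      ‖1 + Complex.I * ((τ * k * u x ^ k : ℝ) : ℂ)‖ * ‖fderiv ℝ u x‖ := by
    have h5 : fderiv ℝ (fun y => g (u y)) x = (fderiv ℝ u x).smulRight
        ((1 + Complex.I * ((τ * k * u x ^ k : ℝ) : ℂ)) *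
        Complex.exp (((τ * u x ^ k : ℝ) : ℂ) * Complex.I)) := by
      rw [hf.fderiv]
      ext h
      simp
    rw [h5, ContinuousLinearMap.norm_smulRight_apply, norm_mul, Complex.norm_exp_ofReal_mul_I,
      mul_one, mul_comm]
  have him : |τ| * k * |u x| ^ k ≤ ‖1 + Complex.I * ((τ * k * u x ^ k : ℝ) : ℂ)‖ := by
    refine le_trans (le_of_eq ?_) (Complex.abs_im_le_norm _)
    rw [Complex.add_im, Complex.I_mul_im, Complex.ofReal_re, Complex.one_im, zero_add, abs_mul,
      abs_mul, abs_pow, Nat.abs_cast]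
  calc |τ| * k / (k + 1) * ‖fderiv ℝ (fun y => u y ^ (k + 1)) x‖
      = (|τ| * k * |u x| ^ k) * ‖fderiv ℝ u x‖ := by rw [hp']; field_simp
    _ ≤ _ := by
      rw [show (fun y => (u y : ℂ) * Complex.exp (Complex.I * τ * ((u y ^ k : ℝ) : ℂ))) =
        fun y => g (u y) from rfl, hv]
      gcongr

/-- Sobolev's inequality for `u ^ m` combined with Hölder's inequality on a set containing the
support of `u`. -/
lemma enorm_integral_pow_le_eLpNorm_fderiv_pow {u : E3 → ℝ} (hu : ContDiff ℝ 1 u)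
    {S : Set E3} (hS : Bornology.IsBounded S) (huS : Function.support u ⊆ S)
    {m : ℕ} (hm : 1 ≤ m) :
    ‖∫ x, u x‖ₑ ^ m ≤ eLpNormLESNormFDerivOfEqInnerConst (volume : Measure E3) 2 *
      eLpNorm (fderiv ℝ (fun x => u x ^ m)) 2 volume * volume S ^ ((m : ℝ) - 1 / 6) := by
  have hm' : (1 : ℝ) ≤ m := by exact_mod_cast hm
  have hcs : HasCompactSupport u :=
    HasCompactSupport.of_support_subset_isCompact hS.isCompact_closure
      (huS.trans subset_closure)
  have hsob := eLpNorm_le_eLpNorm_fderiv_of_eq_inner (volume : Measure E3)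
    (u := fun x => u x ^ m) (hu.pow m) (hcs.comp_left (g := fun y : ℝ => y ^ m)
    (zero_pow (by omega))) (p := 2) (p' := 6) (by norm_num) (by simp) (by simp; norm_num)
  have hpow : eLpNorm (fun x => u x ^ m) 6 volume = eLpNorm u (6 * m) volume ^ m := by
    have := eLpNorm_norm_rpow (μ := (volume : Measure E3)) (p := 6) u (q := m) (by linarith)
    rw [ENNReal.ofReal_natCast, ENNReal.rpow_natCast] at this
    rw [← this, ← eLpNorm_norm]
    simp
  have hint : ‖∫ x, u x‖ₑ ≤ eLpNorm u 1 volume := by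
    rw [eLpNorm_one_eq_lintegral_enorm]
    exact enorm_integral_le_lintegral_enorm _
  have hhol : eLpNorm u 1 volume ≤ eLpNorm u (6 * m) volume * volume S ^ (1 - 1 / (6 * m : ℝ)) := by
    have := eLpNorm_le_eLpNorm_mul_rpow_measure_univ (μ := volume.restrict S) (p := 1)
      (q := 6 * m) (by
        have : (1 : ℝ≥0∞) ≤ m := by exact_mod_cast hm
        calc (1 : ℝ≥0∞) ≤ 6 * 1 := by norm_num
          _ ≤ 6 * m := by gcongr) hu.continuous.aestronglyMeasurable
    rw [eLpNorm_restrict_eq_of_support_subset huS, eLpNorm_restrict_eq_of_support_subset huS] at this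
    simpa using this
  calc ‖∫ x, u x‖ₑ ^ m ≤ (eLpNorm u (6 * m) volume * volume S ^ (1 - 1 / (6 * m : ℝ))) ^ m := by
        gcongr; exact hint.trans hhol
    _ = eLpNorm (fun x => u x ^ m) 6 volume * volume S ^ ((m : ℝ) - 1 / 6) := by
        rw [mul_pow, hpow, ← ENNReal.rpow_mul_natCast]
        congr 2
        field_simp
    _ ≤ _ := by
        gcongr
        exact hsob

lemma integral_rhoeps (ρ : E3 → ℝ) {ε : ℝ} (hε : 0 < ε) : ∫ x, rhoeps ρ ε x = ∫ x, ρ x := by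
  have h : ε⁻¹ ^ 3 = (ε ^ 3)⁻¹ := inv_pow _ _
  simp only [rhoeps]
  rw [integral_const_mul, Measure.integral_comp_inv_smul]
  simp [abs_of_pos hε]
  field_simp

lemma integral_bubble (s γ : ℝ) (φ : E3 → ℝ) {n : ℝ} (hn : 0 < n) :
    ∫ x, bubble s γ φ n x = kap γ n * n ^ ((3 : ℝ) / 2 - s) * (n ^ 3)⁻¹ * ∫ x, φ x := by
  simp only [bubble]
  rw [integral_const_mul, Measure.integral_comp_smul]
  simp [abs_of_pos hn, mul_assoc]

lemma support_bubbleE_subset {s γ : ℝ} {ρ φ : E3 → ℝ} {n ε R : ℝ} (hn : 0 < n) (hε : 0 < ε)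
    (hεn : ε ≤ n⁻¹) (hR : 0 ≤ R) (hρ : Function.support ρ ⊆ Metric.closedBall 0 R)
    (hφ : Function.support φ ⊆ Metric.closedBall 0 1) :
    Function.support (bubbleE s γ ρ φ n ε) ⊆ Metric.closedBall 0 ((R + 1) / n) := by
  refine (support_convolution_subset _).trans ?_
  rintro _ ⟨y, hy, z, hz, rfl⟩
  have hy' : ρ (ε⁻¹ • y) ≠ 0 := fun h => hy (by simp [rhoeps, h])
  have hz' : φ (n • z) ≠ 0 := fun h => hz (by simp [bubble, h])
  have h1 := hρ hy'
  have h2 := hφ hz'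
  rw [mem_closedBall_zero_iff, norm_smul, Real.norm_eq_abs] at h1 h2
  rw [abs_of_pos (inv_pos.2 hε), inv_mul_le_iff₀ hε] at h1
  rw [abs_of_pos hn] at h2
  rw [mem_closedBall_zero_iff]
  calc ‖y + z‖ ≤ ‖y‖ + ‖z‖ := norm_add_le _ _
    _ ≤ n⁻¹ * R + n⁻¹ * 1 := by
      gcongr
      · exact h1.trans (by gcongr)
      · rwa [le_inv_mul_iff₀ hn]
    _ = (R + 1) / n := by field_simp

lemma contDiff_bubbleE {s γ : ℝ} {ρ φ : E3 → ℝ} {n ε : ℝ} (hε : 0 < ε)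
    (hρ_smooth : ContDiff ℝ 1 ρ) (hρ_supp : HasCompactSupport ρ) (hφ : Continuous φ) :
    ContDiff ℝ 1 (bubbleE s γ ρ φ n ε) := by
  have hc : HasCompactSupport (rhoeps ρ ε) :=
    (hρ_supp.comp_smul (inv_ne_zero hε.ne')).mul_left (f := fun _ => (ε ^ 3)⁻¹)
  refine hc.contDiff_convolution_left (n := 1) _ ?_ ?_
  · unfold rhoeps; fun_prop
  · refine Continuous.locallyIntegrable ?_
    unfold bubble; fun_prop

lemma integral_bubbleE {s γ : ℝ} {ρ φ : E3 → ℝ} {n ε : ℝ} (hn : 0 < n) (hε : 0 < ε)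
    (hρ : Continuous ρ) (hρ_supp : HasCompactSupport ρ) (hφ : Continuous φ)
    (hφ_supp : HasCompactSupport φ) :
    ∫ x, bubbleE s γ ρ φ n ε x =
      (∫ x, ρ x) * (kap γ n * n ^ ((3 : ℝ) / 2 - s) * (n ^ 3)⁻¹ * ∫ x, φ x) := by
  have h1 : Integrable (rhoeps ρ ε) :=
    ((hρ.integrable_of_hasCompactSupport hρ_supp).comp_smul (inv_ne_zero hε.ne')).const_mul _
  have h2 : Integrable (bubble s γ φ n) :=
    ((hφ.integrable_of_hasCompactSupport hφ_supp).comp_smul hn.ne').const_mul _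
  simp only [bubbleE, convR]
  rw [integral_convolution _ h1 h2, integral_rhoeps ρ hε, integral_bubble s γ φ hn]
  rfl

lemma kap_pos (γ : ℝ) {n : ℝ} (hn : 1 < n) : 0 < kap γ n :=
  Real.rpow_pos_of_pos (Real.log_pos hn) _

lemma lam_sq (k : ℕ) (s γ : ℝ) {n : ℝ} (hn : 1 < n) :
    lam (k + 1) s γ n ^ 2 = (kap γ n * n ^ ((3 : ℝ) / 2 - s)) ^ k := by
  have hκ := kap_pos γ hn
  have hn0 : 0 < n := by linarith
  rw [lam, mul_pow, mul_pow, ← Real.rpow_mul_natCast hκ.le, ← Real.rpow_mul_natCast hn0.le,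
    ← Real.rpow_mul_natCast hn0.le, ← Real.rpow_natCast (kap γ n)]
  congr 2 <;> push_cast <;> ring

lemma rpow_one_sub_div_cube_rpow (s : ℝ) (m : ℕ) {n : ℝ} (hn : 0 < n) :
    n ^ (1 - s) / (n ^ 3) ^ ((m : ℝ) - 1 / 6) = n ^ ((3 : ℝ) / 2 - s) * ((n ^ 3)⁻¹) ^ m := by
  rw [← inv_pow, ← pow_mul, ← Real.rpow_natCast n⁻¹, Real.inv_rpow hn.le, ← Real.rpow_neg hn.le,
    ← Real.rpow_natCast n 3, ← Real.rpow_mul hn.le, ← Real.rpow_sub hn, ← Real.rpow_add hn]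
  congr 1
  push_cast
  ring

lemma volume_closedBall_rpow {r q : ℝ} (hr : 0 ≤ r) (hq : 0 ≤ q) :
    volume (Metric.closedBall (0 : E3) r) ^ q =
      ENNReal.ofReal ((r ^ 3 * volume.real (Metric.ball (0 : E3) 1)) ^ q) := by
  rw [Measure.addHaar_closedBall _ _ hr, ← ENNReal.ofReal_rpow_of_nonneg (by positivity) hq,
    ENNReal.ofReal_mul (by positivity), measureReal_def, ENNReal.ofReal_toReal measure_ball_lt_top.ne]
  simp

lemma vE_eq {σ : ℝ} {k : ℕ} (hk : Even k) (s γ : ℝ) (ρ φ : E3 → ℝ) (n ε t : ℝ) :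
    vE σ (k + 1) s γ ρ φ n ε t = fun x => (bubbleE s γ ρ φ n ε x : ℂ) *
      Complex.exp (Complex.I * ((σ * t : ℝ) : ℂ) * ((bubbleE s γ ρ φ n ε x ^ k : ℝ) : ℂ)) := by
  funext x
  have h : |bubbleE s γ ρ φ n ε x| ^ (((k + 1 : ℕ) : ℝ) - 1) = bubbleE s γ ρ φ n ε x ^ k := by
    rw [Nat.cast_add_one, add_sub_cancel_right, Real.rpow_natCast, hk.pow_abs]
  rw [vE, h, Complex.ofReal_mul, ← mul_assoc]

/-- The gradient of the profile at time `t` controls the gradient of the `(k + 1)`-st power of the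
regularized bubble. -/
lemma ofReal_mul_eLpNorm_fderiv_bubbleE_pow_le {σ : ℝ} (hσ : σ = 1 ∨ σ = -1) {k : ℕ} (hk : Even k)
    {s γ : ℝ} {ρ φ : E3 → ℝ} {n ε t : ℝ} (ht : 0 ≤ t)
    (hu : ContDiff ℝ 1 (bubbleE s γ ρ φ n ε)) :
    ENNReal.ofReal (t * k / (k + 1)) *
        eLpNorm (fderiv ℝ (fun x => bubbleE s γ ρ φ n ε x ^ (k + 1))) 2 volume ≤
      eLpNorm (fun x => fderiv ℝ (vE σ (k + 1) s γ ρ φ n ε t) x) 2 volume := by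
  have hc : (0 : ℝ) ≤ t * k / (k + 1) := by positivity
  have hτ : |σ * t| = t := by
    rcases hσ with rfl | rfl <;> simp [abs_of_nonneg ht]
  rw [vE_eq hk, ← Real.enorm_of_nonneg hc, ← eLpNorm_const_smul]
  refine eLpNorm_mono fun x => ?_
  have := norm_fderiv_pow_le_norm_fderiv_mul_cexp
    (hu.differentiable one_ne_zero x) (σ * t) k
  rw [hτ] at this
  rwa [Pi.smul_apply, norm_smul, Real.norm_of_nonneg hc]

/-- If `φ ≠ 0`, there are `c > 0` and `N ≥ 2` such that for all `n ≥ N` and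
`ε ∈ (0, (100n)⁻¹]`, `‖∇ v_nᵉ(t_n)‖_{L²} ≥ c κ_n (log n)^{(β-γ)(p-1)} n^{1-s}`, where
the gradient is formalized as the (full) Fréchet derivative. -/
theorem stmt8
    (σ : ℝ) (hσ : σ = 1 ∨ σ = -1)
    (p : ℕ) (hp_odd : Odd p) (hp : 3 ≤ p)
    (s : ℝ) (hs0 : 0 < s) (hs32 : s < 3 / 2)
    (γ β : ℝ) (hγ0 : 0 < γ) (hγβ : γ < β) (hβ1 : β < 1)
    (ρ : E3 → ℝ) (hρ_smooth : ContDiff ℝ (⊤ : ℕ∞) ρ) (hρ_supp : HasCompactSupport ρ)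
    (hρ_nonneg : ∀ x, 0 ≤ ρ x) (hρ_le : ∀ x, ρ x ≤ 1) (hρ_int : ∫ x, ρ x = 1)
    (φ : E3 → ℝ) (hφ_smooth : ContDiff ℝ (⊤ : ℕ∞) φ)
    (hφ_supp : tsupport φ ⊆ Metric.closedBall 0 1)
    (hφ_nonneg : ∀ x, 0 ≤ φ x) (hφ_le : ∀ x, φ x ≤ 1)
    (hφ_ne : φ ≠ 0) :
    ∃ c > 0, ∃ N : ℝ, 2 ≤ N ∧ ∀ n : ℝ, N ≤ n → ∀ ε : ℝ, 0 < ε → ε ≤ (100 * n)⁻¹ →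
      ENNReal.ofReal (c * kap γ n * Real.log n ^ ((β - γ) * ((p : ℝ) - 1)) * n ^ (1 - s)) ≤
        eLpNorm (fun x => fderiv ℝ (vE σ p s γ ρ φ n ε (tinf p s γ β n)) x) 2 volume := by
  obtain ⟨k, rfl⟩ : ∃ k, p = k + 1 := ⟨p - 1, by omega⟩
  have hk : Even k := by
    rcases Nat.even_or_odd k with h | h
    · exact h
    · exact absurd hp_odd (Nat.not_odd_iff_even.2 h.add_one)
  have hk0 : (0 : ℝ) < k := by
    have : 0 < k := by omega
    exact_mod_cast this
  have hφ_supp' : Function.support φ ⊆ Metric.closedBall 0 1 := (subset_tsupport φ).trans hφ_supp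
  have hφ_cs : HasCompactSupport φ :=
    HasCompactSupport.of_support_subset_isCompact (isCompact_closedBall _ _) hφ_supp'
  have hM : 0 < ∫ x, φ x := by
    obtain ⟨x, hx⟩ := Function.ne_iff.1 hφ_ne
    exact hφ_smooth.continuous.integral_pos_of_hasCompactSupport_nonneg_nonzero hφ_cs
      hφ_nonneg hx
  obtain ⟨R, hR0, hR⟩ : ∃ R : ℝ, 0 ≤ R ∧ Function.support ρ ⊆ Metric.closedBall 0 R := by
    obtain ⟨R, hR⟩ := hρ_supp.isCompact.isBounded.subset_closedBall (0 : E3)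
    exact ⟨max R 0, le_max_right _ _, (subset_tsupport ρ).trans
      (hR.trans (Metric.closedBall_subset_closedBall (le_max_left _ _)))⟩
  set M := ∫ x, φ x
  set C : ℝ := eLpNormLESNormFDerivOfEqInnerConst (volume : Measure E3) 2 + 1 with hC
  have hC0 : 0 < C := by positivity
  set V : ℝ := volume.real (Metric.ball (0 : E3) 1) with hV
  have hV0 : 0 < V :=
    ENNReal.toReal_pos (Metric.measure_ball_pos _ _ one_pos).ne' measure_ball_lt_top.ne
  set q : ℝ := ((k + 1 : ℕ) : ℝ) - 1 / 6 with hq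
  have hq0 : 0 ≤ q := by rw [hq]; push_cast; linarith
  set W : ℝ := (R + 1) ^ 3 * V with hW
  have hW0 : 0 < W := by positivity
  refine ⟨k / (k + 1) * M ^ (k + 1) / (C * W ^ q), by positivity, 2, le_rfl, ?_⟩
  intro n hn ε hε hεn
  have hn1 : 1 < n := by linarith
  have hn0 : 0 < n := by linarith
  have hεn' : ε ≤ n⁻¹ := hεn.trans (by gcongr; linarith)
  have hu : ContDiff ℝ 1 (bubbleE s γ ρ φ n ε) :=
    contDiff_bubbleE hε (hρ_smooth.of_le (by simp)) hρ_supp hφ_smooth.continuous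
  have hκ := kap_pos γ hn1
  set A : ℝ := kap γ n * n ^ ((3 : ℝ) / 2 - s) with hA
  have hA0 : 0 < A := by positivity
  set L : ℝ := Real.log n ^ ((β - γ) * (((k + 1 : ℕ) : ℝ) - 1)) with hL
  have hL0 : 0 < L := Real.rpow_pos_of_pos (Real.log_pos hn1) _
  have ht : tinf (k + 1) s γ β n = (A ^ k)⁻¹ * L := by rw [tinf, lam_sq k s γ hn1]
  set t := tinf (k + 1) s γ β n
  have ht0 : 0 ≤ t := by rw [ht]; positivity
  have hgrad := ofReal_mul_eLpNorm_fderiv_bubbleE_pow_le hσ hk ht0 hu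
  have hsob := enorm_integral_pow_le_eLpNorm_fderiv_pow hu Metric.isBounded_closedBall
    (support_bubbleE_subset hn0 hε hεn' hR0 hR hφ_supp') (m := k + 1) (by omega)
  rw [volume_closedBall_rpow (by positivity) hq0, integral_bubbleE hn0 hε hρ_smooth.continuous
    hρ_supp hφ_smooth.continuous hφ_cs, hρ_int, one_mul, Real.enorm_of_nonneg (by positivity),
    ← ENNReal.ofReal_pow (by positivity)] at hsob
  have hD : (((R + 1) / n) ^ 3 * V) ^ q = W ^ q / (n ^ 3) ^ q := by
    rw [← Real.div_rpow hW0.le (by positivity)]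
    congr 1
    rw [hW]
    field_simp
  rw [← hV, hD] at hsob
  set D : ℝ := W ^ q / (n ^ 3) ^ q with hDdef
  have hD0 : 0 < D := by positivity
  have hCle : (eLpNormLESNormFDerivOfEqInnerConst (volume : Measure E3) 2 : ℝ≥0∞) ≤
      ENNReal.ofReal C := by
    rw [hC, ← ENNReal.ofReal_coe_nnreal]
    exact ENNReal.ofReal_le_ofReal (by linarith)
  set X : ℝ := k / (k + 1) * M ^ (k + 1) / (C * W ^ q) * kap γ n * L * n ^ (1 - s) with hX
  have hX0 : 0 < X := by positivity
  have hid : X * (C * D) = t * k / (k + 1) * (A * (n ^ 3)⁻¹ * M) ^ (k + 1) := by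
    calc X * (C * D)
        = k / (k + 1) * M ^ (k + 1) * kap γ n * L * (n ^ (1 - s) / (n ^ 3) ^ q) := by
          rw [hX, hDdef]; field_simp
      _ = k / (k + 1) * M ^ (k + 1) * L * A * ((n ^ 3)⁻¹) ^ (k + 1) := by
          rw [rpow_one_sub_div_cube_rpow s (k + 1) hn0, hA]; ring
      _ = _ := by
          rw [ht, mul_pow _ M, mul_pow A, pow_succ A]; field_simp
  have hCD : 0 < C * D := by positivity
  rw [← ENNReal.mul_le_mul_iff_left (ENNReal.ofReal_pos.2 hCD).ne' ENNReal.ofReal_ne_top,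
    ← ENNReal.ofReal_mul hX0.le, hid, ENNReal.ofReal_mul (by positivity),
    ENNReal.ofReal_mul hC0.le]
  refine (mul_le_mul_right hsob _).trans ?_
  refine le_trans ?_ (mul_le_mul_left hgrad _)
  refine le_trans (mul_le_mul_right (mul_le_mul_left (mul_le_mul_left hCle _) _) _) ?_
  exact le_of_eq (by ring)
end
end
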